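/- Let N ≥ 2 be an integer and suppose the element (x − α)(β − x) of ℝ[C] can be written as a sum of squares g₁² + ⋯ + g_r² with δ(g_j) ≤ N for all j. Then for every integer d ≥ 1 and every polynomial p ∈ ℝ[x,y] of total degree ≤ d with p(u,v) ≥ 0 for all (u,v) ∈ ℝ² satisfying v² + q(u) = 0, there exist finitely many polynomials p₁, …, p_m ∈ ℝ[x,y] of total degree ≤ N + d − 1 such that p − (p₁² + ⋯ + p_m²) lies in the ideal of ℝ[x,y] generated by y² + q(x). -/

import Mathlib

open Polynomial

noncomputable section

/-- The defining polynomial `y² + q(x)` of the curve, as a polynomial in `y`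
over `ℝ[x]`. -/
def curvePoly (q : Polynomial ℝ) : Polynomial (Polynomial ℝ) :=
  X ^ 2 + C q

lemma curvePoly_monic (q : Polynomial ℝ) : (curvePoly q).Monic :=
  Polynomial.monic_X_pow_add_C q (by norm_num)

/-- The coordinate ring `ℝ[C] = ℝ[x,y]/(y² + q(x))`. -/
abbrev CurveRing (q : Polynomial ℝ) : Type := AdjoinRoot (curvePoly q)

/-- The unique representative `a(x) + b(x)·y` (of `y`-degree `< 2`) of an element. -/
def curveRep (q : Polynomial ℝ) (f : CurveRing q) : Polynomial (Polynomial ℝ) :=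
  AdjoinRoot.modByMonicHom (curvePoly_monic q) f

/-- The polynomial `a(x)` with `f = a(x) + b(x)·y`. -/
def repA (q : Polynomial ℝ) (f : CurveRing q) : Polynomial ℝ := (curveRep q f).coeff 0

/-- The polynomial `b(x)` with `f = a(x) + b(x)·y`. -/
def repB (q : Polynomial ℝ) (f : CurveRing q) : Polynomial ℝ := (curveRep q f).coeff 1

/-- `δ(f) = max (deg a, 2 + deg b)` for `f = a(x) + b(x)·y ≠ 0`. -/
def curveDelta (q : Polynomial ℝ) (f : CurveRing q) : ℕ :=
  if repB q f = 0 then (repA q f).natDegree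
  else max (repA q f).natDegree (2 + (repB q f).natDegree)

/-- `f ∈ ℝ[C]` is psd: nonnegative at all real points of the curve. -/
def IsPsd (q : Polynomial ℝ) (f : CurveRing q) : Prop :=
  ∀ u v : ℝ, v ^ 2 + q.eval u = 0 → 0 ≤ (repA q f).eval u + (repB q f).eval u * v

/-- `f` is a sum of squares of elements of `δ`-degree at most `d`. -/
def IsSosLe (q : Polynomial ℝ) (f : CurveRing q) (d : ℕ) : Prop :=
  ∃ (r : ℕ) (g : Fin r → CurveRing q), f = ∑ i, g i ^ 2 ∧ ∀ i, curveDelta q (g i) ≤ d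

/-- `θ(f)`: the least `d` such that `f` is a sum of squares of elements of
`δ`-degree `≤ d`, and `∞` if `f` is not a sum of squares. -/
def curveTheta (q : Polynomial ℝ) (f : CurveRing q) : ℕ∞ :=
  sInf {d : ℕ∞ | ∃ n : ℕ, d = (n : ℕ∞) ∧ IsSosLe q f n}

/-- All zeros of `f` on `C(ℂ)` are real. -/
def AllZerosReal (q : Polynomial ℝ) (f : CurveRing q) : Prop :=
  ∀ u v : ℂ, v ^ 2 + (q.map (algebraMap ℝ ℂ)).eval u = 0 →
    ((repA q f).map (algebraMap ℝ ℂ)).eval u +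
      ((repB q f).map (algebraMap ℝ ℂ)).eval u * v = 0 →
    u.im = 0 ∧ v.im = 0

/-- The span of the face of `f` in the cone of elements that are nonnegative under `ψ`. -/
def faceSpan {X V : Type*} [AddCommGroup V] [Module ℝ V] (ψ : V →ₗ[ℝ] (X → ℝ)) (f : V) :
    Submodule ℝ V where
  carrier := {g | ∃ c : ℝ, ∀ x, |ψ g x| ≤ c * ψ f x}
  zero_mem' := ⟨0, by simp⟩
  add_mem' := by
    rintro g h ⟨c, hc⟩ ⟨e, he⟩
    refine ⟨c + e, fun x => ?_⟩
    have := abs_add_le (ψ g x) (ψ h x)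
    simp only [map_add, Pi.add_apply]
    linarith [hc x, he x]
  smul_mem' := by
    rintro r g ⟨c, hc⟩
    refine ⟨|r| * c, fun x => ?_⟩
    simp only [map_smul, Pi.smul_apply, smul_eq_mul, abs_mul, mul_assoc]
    exact mul_le_mul_of_nonneg_left (hc x) (abs_nonneg r)

lemma exists_boundary_of_mem_faceSpan {X V : Type*} [AddCommGroup V] [Module ℝ V]
    [FiniteDimensional ℝ V] (ψ : V →ₗ[ℝ] (X → ℝ)) (hψ : Function.Injective ψ) {f g : V}
    (hf0 : f ≠ 0) (hf : ∀ x, 0 ≤ ψ f x) (hg : g ∈ faceSpan ψ f) :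
    ∃ s : ℝ, (∀ x, 0 ≤ ψ (g - s • f) x) ∧ ∀ k : ℝ, 0 < k →
      Module.finrank ℝ (faceSpan ψ (k • (g - s • f))) < Module.finrank ℝ (faceSpan ψ f) := by
  obtain ⟨x₀, hx₀⟩ : ∃ x, 0 < ψ f x := by
    by_contra! h
    exact hf0 (hψ (by ext x; simpa using le_antisymm (h x) (hf x)))
  obtain ⟨c, hc⟩ := hg
  set T : Set ℝ := {s | ∀ x, s * ψ f x ≤ ψ g x} with hT
  have hne : T.Nonempty := ⟨-c, fun x => by linarith [neg_abs_le (ψ g x), hc x]⟩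
  have hbdd : BddAbove T := ⟨ψ g x₀ / ψ f x₀, fun s hs => (le_div_iff₀ hx₀).2 (hs x₀)⟩
  have hmem : sSup T ∈ T := by
    intro x
    rcases (hf x).eq_or_lt with h | h
    · obtain ⟨s, hs⟩ := hne
      have := hs x
      rw [← h] at this ⊢
      simpa using this
    · rw [← le_div_iff₀ h]
      exact csSup_le hne fun s hs => (le_div_iff₀ h).2 (hs x)
  refine ⟨sSup T, fun x => ?_, fun k hk => ?_⟩
  · simpa using hmem x
  · apply Submodule.finrank_lt_finrank_of_lt
    refine lt_of_le_of_ne ?_ ?_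
    · rintro h ⟨e, he⟩
      refine ⟨|e| * (k * (c + |sSup T|)), fun x => (he x).trans ?_⟩
      have h1 : ψ (k • (g - sSup T • f)) x ≤ k * (c + |sSup T|) * ψ f x := by
        simp only [map_smul, map_sub, Pi.smul_apply, Pi.sub_apply, smul_eq_mul, mul_assoc]
        refine mul_le_mul_of_nonneg_left ?_ hk.le
        nlinarith [hc x, le_abs_self (ψ g x), neg_abs_le (sSup T), hf x]
      have h2 : 0 ≤ ψ (k • (g - sSup T • f)) x := by
        simp only [map_smul, map_sub, Pi.smul_apply, Pi.sub_apply, smul_eq_mul]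
        exact mul_nonneg hk.le (by linarith [hmem x])
      calc e * ψ (k • (g - sSup T • f)) x ≤ |e| * ψ (k • (g - sSup T • f)) x :=
            mul_le_mul_of_nonneg_right (le_abs_self e) h2
        _ ≤ _ := by
            rw [mul_assoc]
            exact mul_le_mul_of_nonneg_left h1 (abs_nonneg e)
    · intro heq
      have hff : f ∈ faceSpan ψ f := ⟨1, fun x => by rw [abs_of_nonneg (hf x), one_mul]⟩
      rw [← heq] at hff
      obtain ⟨e, he⟩ := hff
      simp only [map_smul, map_sub, Pi.smul_apply, Pi.sub_apply, smul_eq_mul] at he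
      have hepos : 0 < e := by
        have h1 := he x₀
        rw [abs_of_pos hx₀] at h1
        have h2 : 0 ≤ k * (ψ g x₀ - sSup T * ψ f x₀) :=
          mul_nonneg hk.le (by linarith [hmem x₀])
        by_contra! h
        nlinarith
      have : sSup T + 1 / (e * k) ∈ T := by
        intro x
        have h1 := he x
        rw [abs_of_nonneg (hf x), ← mul_assoc] at h1
        have h2 : 1 / (e * k) * ψ f x ≤ ψ g x - sSup T * ψ f x := by
          rw [one_div, inv_mul_le_iff₀ (by positivity)]
          exact h1
        linarith
      have := le_csSup hbdd this
      have : 0 < 1 / (e * k) := by positivity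
      linarith

/-- A property that holds for the extreme rays of the cone of nonnegative elements in a
finite-dimensional space of functions and is stable under sums holds on the whole cone. -/
theorem nonneg_induction_of_extreme {X V : Type*} [AddCommGroup V] [Module ℝ V]
    [FiniteDimensional ℝ V] (ψ : V →ₗ[ℝ] (X → ℝ)) (hψ : Function.Injective ψ)
    {P : V → Prop} (zero : P 0) (hadd : ∀ f g, P f → P g → P (f + g))
    (extreme : ∀ f, f ≠ 0 → (∀ x, 0 ≤ ψ f x) → (∀ g ∈ faceSpan ψ f, ∃ c : ℝ, g = c • f) → P f)
    (f : V) (hf : ∀ x, 0 ≤ ψ f x) : P f := by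
  induction hn : Module.finrank ℝ (faceSpan ψ f) using Nat.strong_induction_on generalizing f with
  | _ n ih =>
  by_cases hf0 : f = 0
  · exact hf0 ▸ zero
  by_cases hex : ∀ g ∈ faceSpan ψ f, ∃ c : ℝ, g = c • f
  · exact extreme f hf0 hf hex
  push Not at hex
  obtain ⟨g, hg, hgf⟩ := hex
  obtain ⟨s, hs, hs'⟩ := exists_boundary_of_mem_faceSpan ψ hψ hf0 hf hg
  obtain ⟨t, ht, ht'⟩ := exists_boundary_of_mem_faceSpan ψ hψ hf0 hf (neg_mem hg)
  have hsum : (g - s • f) + (-g - t • f) = (-(s + t)) • f := by module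
  obtain ⟨x₀, hx₀⟩ : ∃ x, 0 < ψ f x := by
    by_contra! h
    exact hf0 (hψ (by ext x; simpa using le_antisymm (h x) (hf x)))
  have hle : ∀ x, 0 ≤ (-(s + t)) * ψ f x := fun x => by
    have := congrFun (congrArg ψ hsum) x
    simp only [map_add, map_smul, Pi.add_apply, Pi.smul_apply, smul_eq_mul] at this
    rw [← this]
    exact add_nonneg (hs x) (ht x)
  have hpos : 0 < -(s + t) := by
    have h1 : 0 ≤ -(s + t) := by
      by_contra! h
      nlinarith [hle x₀]
    refine lt_of_le_of_ne h1 fun h => hgf s ?_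
    apply hψ
    ext x
    have h2 := hs x
    have h3 := ht x
    simp only [map_sub, map_neg, map_smul, Pi.sub_apply, Pi.neg_apply, Pi.smul_apply,
      smul_eq_mul] at h2 h3 ⊢
    have : t = -s := by linarith
    rw [this] at h3
    linarith
  set k := (-(s + t))⁻¹ with hk
  have hkpos : 0 < k := inv_pos.2 hpos
  have hfeq : f = k • (g - s • f) + k • (-g - t • f) := by
    rw [← smul_add, hsum, smul_smul, hk, inv_mul_cancel₀ hpos.ne', one_smul]
  rw [hfeq]
  subst hn
  refine hadd _ _ (ih _ (hs' k hkpos) _ (fun x => ?_) rfl) (ih _ (ht' k hkpos) _ (fun x => ?_) rfl)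
  · rw [map_smul]; exact mul_nonneg hkpos.le (hs x)
  · rw [map_smul]; exact mul_nonneg hkpos.le (ht x)
lemma exists_squarefree_mul_sq {H : ℝ[X]} (hH : H ≠ 0) :
    ∃ Q M : ℝ[X], H = Q * M ^ 2 ∧ Squarefree Q := by
  induction hn : H.natDegree using Nat.strong_induction_on generalizing H with
  | _ n ih =>
  by_cases hs : Squarefree H
  · exact ⟨H, 1, by ring, hs⟩
  obtain ⟨p, ⟨H', rfl⟩, hpu⟩ : ∃ p, p * p ∣ H ∧ ¬ IsUnit p := by
    simpa [Squarefree] using hs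
  have hp0 : p ≠ 0 := by rintro rfl; simp at hH
  have hH' : H' ≠ 0 := right_ne_zero_of_mul hH
  have hdeg : 0 < p.natDegree :=
    natDegree_pos_iff_degree_pos.2 (degree_pos_of_ne_zero_of_nonunit hp0 hpu)
  rw [natDegree_mul (mul_ne_zero hp0 hp0) hH', natDegree_mul hp0 hp0] at hn
  obtain ⟨Q, M, h, hQ⟩ := ih H'.natDegree (by omega) hH' rfl
  exact ⟨Q, p * M, by rw [h]; ring, hQ⟩

lemma Squarefree.dvd_of_forall_irreducible_dvd {Q q : ℝ[X]} (hQ : Squarefree Q)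
    (h : ∀ p, Irreducible p → p ∣ Q → p ∣ q) : Q ∣ q := by
  obtain ⟨Q₁, hQ₁⟩ := EuclideanDomain.gcd_dvd_left Q q
  by_cases hu : IsUnit Q₁
  · have : Associated (EuclideanDomain.gcd Q q) Q := ⟨hu.unit, hQ₁.symm⟩
    exact this.symm.dvd.trans (EuclideanDomain.gcd_dvd_right Q q)
  · have hQ0 : Q₁ ≠ 0 := by
      rintro rfl
      exact hQ.ne_zero (by simpa using hQ₁)
    obtain ⟨p, hp, hpQ₁⟩ := WfDvdMonoid.exists_irreducible_factor hu hQ0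
    have hpQ : p ∣ Q := hQ₁ ▸ hpQ₁.mul_left _
    refine absurd (hQ p ?_) hp.not_isUnit
    rw [hQ₁]
    exact mul_dvd_mul (EuclideanDomain.dvd_gcd hpQ (h p hp hpQ)) hpQ₁

lemma Squarefree.dvd_of_sq_dvd_mul_sq {R : Type*} [EuclideanDomain R] {q M B : R}
    (hq : Squarefree q) (h : M ^ 2 ∣ q * B ^ 2) : M ∣ B := by
  classical
  by_cases hB : B = 0
  · exact hB ▸ dvd_zero M
  have hg : EuclideanDomain.gcd M B ≠ 0 := fun h => hB (EuclideanDomain.gcd_eq_zero_iff.1 h).2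
  have hab := EuclideanDomain.gcd_eq_gcd_ab M B
  generalize EuclideanDomain.gcdA M B = x, EuclideanDomain.gcdB M B = y at hab
  obtain ⟨m, hm⟩ := EuclideanDomain.gcd_dvd_left M B
  obtain ⟨b, hb⟩ := EuclideanDomain.gcd_dvd_right M B
  generalize EuclideanDomain.gcd M B = g at *
  subst hm hb
  have hco : IsCoprime m b := ⟨x, y, mul_left_cancel₀ hg (by linear_combination -hab)⟩
  rw [mul_pow, mul_pow, mul_left_comm, mul_dvd_mul_iff_left (pow_ne_zero 2 hg)] at h
  have hm : m * m ∣ q := by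
    rw [← pow_two]
    exact hco.pow.dvd_of_dvd_mul_right h
  exact mul_dvd_mul_left g (hq m hm).dvd

lemma X_sub_C_sq_dvd_of_nonneg {P : ℝ[X]} {s : ℝ} (h0 : P.eval s = 0)
    (h : ∀ᶠ x in nhds s, 0 ≤ P.eval x) : (X - C s) ^ 2 ∣ P := by
  by_cases hP : P = 0
  · exact hP ▸ dvd_zero _
  have hmin : IsLocalMin (fun x => P.eval x) s := by
    filter_upwards [h] with x hx
    rwa [h0]
  have hd := hmin.deriv_eq_zero
  rw [Polynomial.deriv] at hd
  have := (one_lt_rootMultiplicity_iff_isRoot hP).2 ⟨h0, hd⟩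
  exact (le_rootMultiplicity_iff hP).1 this

lemma exists_sq_of_nonneg_of_linear {P : ℝ[X]} (hP0 : P ≠ 0) (h : ∀ x, 0 ≤ P.eval x)
    (hlin : ∀ p, Irreducible p → p ∣ P → ∃ s, X - C s ∣ p) : ∃ K : ℝ[X], P = K ^ 2 := by
  induction hn : P.natDegree using Nat.strong_induction_on generalizing P with
  | _ n ih =>
  by_cases hu : IsUnit P
  · obtain ⟨c, -, rfl⟩ := Polynomial.isUnit_iff.1 hu
    refine ⟨C (√c), ?_⟩
    rw [← C_pow, Real.sq_sqrt (by simpa using h 0)]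
  · obtain ⟨p, hp, hpP⟩ := WfDvdMonoid.exists_irreducible_factor hu hP0
    obtain ⟨s, hs⟩ := hlin p hp hpP
    obtain ⟨P', rfl⟩ := X_sub_C_sq_dvd_of_nonneg (dvd_iff_isRoot.1 (hs.trans hpP))
      (Filter.Eventually.of_forall h)
    have hP' : P' ≠ 0 := right_ne_zero_of_mul hP0
    have hX : (X - C s) ^ 2 ≠ 0 := pow_ne_zero _ (X_sub_C_ne_zero s)
    rw [natDegree_mul hX hP', natDegree_pow, natDegree_X_sub_C] at hn
    have hpos : ∀ x, x ≠ s → 0 ≤ P'.eval x := fun x hx => by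
      have h1 := h x
      rw [eval_mul] at h1
      refine nonneg_of_mul_nonneg_right h1 ?_
      have : x - s ≠ 0 := sub_ne_zero.2 hx
      simp only [eval_pow, eval_sub, eval_X, eval_C]
      positivity
    have hcl : ∀ x, 0 ≤ P'.eval x := by
      have hd : Dense {x : ℝ | x ≠ s} := dense_compl_singleton s
      have hc : IsClosed {x | 0 ≤ P'.eval x} := isClosed_le continuous_const P'.continuous
      intro x
      exact hc.closure_subset_iff.2 hpos (hd x)
    obtain ⟨K, rfl⟩ := ih P'.natDegree (by omega) hP' hcl
      (fun p hp hpP => hlin p hp (hpP.mul_left _)) rfl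
    exact ⟨(X - C s) * K, by ring⟩

lemma not_dvd_of_squarefree_mul_sq {p Q M u w b : ℝ[X]} (hp : Irreducible p)
    (hQ : Squarefree Q) (hu : ¬ p ∣ u) (hw : ¬ p ∣ w) (hb : b ≠ 0)
    (h : Q * M ^ 2 * u = w * b ^ 2) : ¬ p ∣ Q := by
  intro hpQ
  have hw0 : w ≠ 0 := by rintro rfl; simp at hw
  have hne : Q * M ^ 2 * u ≠ 0 := h ▸ mul_ne_zero hw0 (pow_ne_zero _ hb)
  have hM : M ≠ 0 := by rintro rfl; simp at hne
  have hpp := hp.prime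
  have fin : ∀ {f : ℝ[X]}, f ≠ 0 → emultiplicity p f = multiplicity p f := fun hf =>
    (FiniteMultiplicity.of_not_isUnit hp.not_isUnit hf).emultiplicity_eq_multiplicity
  have hQ1 : emultiplicity p Q = 1 := by
    apply le_antisymm
    · exact ((squarefree_iff_emultiplicity_le_one Q).1 hQ p).resolve_right hp.not_isUnit
    · simpa using pow_dvd_iff_le_emultiplicity.1 (show p ^ 1 ∣ Q by simpa using hpQ)
  have := congrArg (emultiplicity p) h
  rw [emultiplicity_mul hpp, emultiplicity_mul hpp, emultiplicity_mul hpp, emultiplicity_pow hpp,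
    emultiplicity_pow hpp, emultiplicity_eq_zero.2 hu, emultiplicity_eq_zero.2 hw, hQ1, fin hM,
    fin hb] at this
  norm_cast at this
  omega

/-- The norm of `a + b y` from the coordinate ring of `y ^ 2 + q` to the polynomial ring. -/
def curveNorm (q a b : ℝ[X]) : ℝ[X] := a ^ 2 + q * b ^ 2

lemma curveNorm_mul (q a b r e : ℝ[X]) :
    curveNorm q (a * r - q * b * e) (a * e + b * r) = curveNorm q a b * curveNorm q r e := by
  unfold curveNorm; ring

lemma curveNorm_C_mul (q p a b : ℝ[X]) : curveNorm q (p * a) (p * b) = p ^ 2 * curveNorm q a b := by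
  unfold curveNorm; ring

lemma degree_curveNorm {q : ℝ[X]} (hmonic : q.Monic) (hdeg : q.natDegree = 4) (a b : ℝ[X]) :
    (curveNorm q a b).degree = max (2 • a.degree) (4 + 2 • b.degree) := by
  have hq : q.degree = 4 := by rw [degree_eq_natDegree hmonic.ne_zero, hdeg]; rfl
  by_cases h : a = 0 ∧ b = 0
  · obtain ⟨rfl, rfl⟩ := h
    simp [curveNorm]
  unfold curveNorm
  rw [degree_add_eq_of_leadingCoeff_add_ne_zero, degree_mul, degree_pow, degree_pow, hq]
  rw [leadingCoeff_mul, hmonic.leadingCoeff, leadingCoeff_pow, leadingCoeff_pow, one_mul]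
  intro h0
  refine h ⟨leadingCoeff_eq_zero.1 ?_, leadingCoeff_eq_zero.1 ?_⟩ <;>
    nlinarith [sq_nonneg a.leadingCoeff, sq_nonneg b.leadingCoeff]

lemma curveNorm_eq_zero {q : ℝ[X]} (hmonic : q.Monic) (hdeg : q.natDegree = 4) {a b : ℝ[X]}
    (h : curveNorm q a b = 0) : a = 0 ∧ b = 0 := by
  have := degree_curveNorm hmonic hdeg a b
  rw [h, degree_zero, eq_comm, max_eq_bot] at this
  constructor
  · rw [← degree_eq_bot]
    cases ha : a.degree
    · rfl
    · rw [ha] at this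
      exact absurd this.1 (WithBot.coe_ne_bot)
  · rw [← degree_eq_bot]
    cases hb : b.degree
    · rfl
    · rw [hb] at this
      exact absurd this.2 (WithBot.coe_ne_bot)

lemma natDegree_curveNorm {q : ℝ[X]} (hmonic : q.Monic) (hdeg : q.natDegree = 4) {a b : ℝ[X]}
    (hb : b ≠ 0) :
    (curveNorm q a b).natDegree = max (2 * a.natDegree) (4 + 2 * b.natDegree) := by
  have h := degree_curveNorm hmonic hdeg a b
  have h0 : curveNorm q a b ≠ 0 := fun h => hb (curveNorm_eq_zero hmonic hdeg h).2
  rw [degree_eq_natDegree h0, degree_eq_natDegree hb] at h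
  by_cases ha : a = 0
  · subst ha
    simp only [degree_zero, nsmul_eq_mul, natDegree_zero] at h ⊢
    rw [show ((2 : ℕ) : WithBot ℕ) * ⊥ = ⊥ from rfl, max_bot_left] at h
    norm_cast at h
  · rw [degree_eq_natDegree ha] at h
    simp only [nsmul_eq_mul] at h
    norm_cast at h
    rcases le_total (2 * a.natDegree) (4 + 2 * b.natDegree) with h' | h'
    · rw [max_eq_right h']
      rw [max_eq_right (by exact_mod_cast h')] at h
      exact_mod_cast h
    · rw [max_eq_left h']
      rw [max_eq_left (by exact_mod_cast h')] at h
      exact_mod_cast h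

lemma even_natDegree_curveNorm {q : ℝ[X]} (hmonic : q.Monic) (hdeg : q.natDegree = 4)
    (a b : ℝ[X]) : Even (curveNorm q a b).natDegree := by
  by_cases hb : b = 0
  · subst hb
    simp [curveNorm, natDegree_pow]
  · rw [natDegree_curveNorm hmonic hdeg hb]
    rcases max_choice (2 * a.natDegree) (4 + 2 * b.natDegree) with h | h <;> rw [h]
    · exact even_two_mul _
    · exact ⟨2 + b.natDegree, by omega⟩

lemma natDegree_curveNorm_le_iff {q : ℝ[X]} (hmonic : q.Monic) (hdeg : q.natDegree = 4)
    {a b : ℝ[X]} {k : ℕ} :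
    (curveNorm q a b).natDegree ≤ 2 * k ↔ a.natDegree ≤ k ∧ (b ≠ 0 → b.natDegree + 2 ≤ k) := by
  by_cases hb : b = 0
  · subst hb
    simp [curveNorm, natDegree_pow]
  · rw [natDegree_curveNorm hmonic hdeg hb, max_le_iff]
    simp only [ne_eq, hb, not_false_eq_true, forall_const]
    omega

lemma natDegree_curveNorm_le_iff_degreeLT {q : ℝ[X]} (hmonic : q.Monic) (hdeg : q.natDegree = 4)
    {a b : ℝ[X]} {k : ℕ} (hk : 1 ≤ k) :
    (curveNorm q a b).natDegree ≤ 2 * k ↔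
      a ∈ degreeLT ℝ (k + 1) ∧ b ∈ degreeLT ℝ (k - 1) := by
  rw [natDegree_curveNorm_le_iff hmonic hdeg, mem_degreeLT, mem_degreeLT]
  refine and_congr ?_ ?_
  · rw [natDegree_le_iff_degree_le]
    by_cases ha : a = 0
    · simp [ha]
    · rw [degree_eq_natDegree ha]; norm_cast; omega
  · by_cases hb : b = 0
    · simp [hb]
    · rw [degree_eq_natDegree hb]; norm_cast; simp only [hb, not_false_eq_true, forall_const]; omega

lemma squarefree_of_squarefree_map {q : ℝ[X]} (h : Squarefree (q.map (algebraMap ℝ ℂ))) :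
    Squarefree q := by
  intro p hp
  have := h (p.map (algebraMap ℝ ℂ)) (by rw [← Polynomial.map_mul]; exact Polynomial.map_dvd _ hp)
  have h0 := degree_eq_zero_of_isUnit this
  rw [degree_map] at h0
  exact isUnit_iff_degree_eq_zero.2 h0

lemma eval_pos_of_lt_roots {q : ℝ[X]} (hmonic : q.Monic) (hdeg : 0 < q.natDegree) {u : ℝ}
    (h : ∀ x, u ≤ x → q.eval x ≠ 0) : 0 < q.eval u := by
  by_contra! hu
  have ht : Filter.Tendsto (fun x => q.eval x) Filter.atTop Filter.atTop :=
    q.tendsto_atTop_of_leadingCoeff_nonneg (natDegree_pos_iff_degree_pos.1 hdeg)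
      (by rw [hmonic.leadingCoeff]; exact zero_le_one)
  obtain ⟨w, hw, hw'⟩ := ((ht.eventually_ge_atTop 0).and (Filter.eventually_ge_atTop u)).exists
  obtain ⟨x, hx, hx0⟩ := intermediate_value_Icc hw' q.continuous.continuousOn ⟨hu, hw⟩
  exact h x hx.1 hx0

lemma mem_Icc_of_eval_nonpos {q : ℝ[X]} (hmonic : q.Monic) (hdeg : q.natDegree = 4) {α β : ℝ}
    (hαβ : ∀ x, q.eval x = 0 → α ≤ x ∧ x ≤ β) {u : ℝ} (hu : q.eval u ≤ 0) :
    α ≤ u ∧ u ≤ β := by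
  constructor
  · by_contra! h
    have hm : (q.comp (-X)).Monic := by
      rw [Monic, leadingCoeff_comp (by simp), hmonic.leadingCoeff, hdeg]
      norm_num [leadingCoeff_neg]
    have hd : (q.comp (-X)).natDegree = 4 := by rw [natDegree_comp]; simp [hdeg]
    have := eval_pos_of_lt_roots (u := -u) hm (by omega) fun x hx h0 => by
      have := (hαβ (-x) (by simpa using h0)).1
      linarith
    simp only [eval_comp, eval_neg, eval_X, neg_neg] at this
    linarith
  · by_contra! h
    have := eval_pos_of_lt_roots (u := u) hmonic (by omega) fun x hx h0 => by
      have := (hαβ x h0).2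
      linarith
    linarith

lemma frequently_eval_neg {q : ℝ[X]} (hsq : Squarefree q) {s : ℝ} (hs : q.eval s = 0) :
    ∃ᶠ u in nhds s, q.eval u < 0 := by
  intro h
  have := X_sub_C_sq_dvd_of_nonneg hs (by simpa using h)
  rw [pow_two] at this
  exact not_isUnit_X_sub_C s (hsq _ this)

lemma isCompact_curve {q : ℝ[X]} (hmonic : q.Monic) (hdeg : q.natDegree = 4) {α β : ℝ}
    (hαβ : ∀ x, q.eval x = 0 → α ≤ x ∧ x ≤ β) :
    IsCompact {w : ℝ × ℝ | w.2 ^ 2 + q.eval w.1 = 0} := by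
  obtain ⟨c, hc⟩ := (isCompact_Icc (a := α) (b := β)).exists_bound_of_continuousOn
    q.continuous.continuousOn
  refine IsCompact.of_isClosed_subset
    ((isCompact_Icc (a := α) (b := β)).prod (isCompact_Icc (a := -(c + 1)) (b := c + 1))) ?_ ?_
  · have := q.continuous
    exact isClosed_eq (by fun_prop) continuous_const
  · rintro ⟨u, v⟩ h
    simp only [Set.mem_ofPred_eq] at h
    have hu := mem_Icc_of_eval_nonpos hmonic hdeg hαβ (u := u) (by nlinarith [sq_nonneg v])
    have h1 := hc u hu
    rw [Real.norm_eq_abs] at h1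
    have h2 := neg_abs_le (q.eval u)
    refine ⟨hu, abs_le.1 (abs_le_of_sq_le_sq ?_ ?_)⟩
    · nlinarith [abs_nonneg (q.eval u)]
    · linarith [abs_nonneg (q.eval u)]

/-- Nonnegativity of `a + b y` on the real points of the curve `y ^ 2 + q(x) = 0`. -/
def CurveNonneg (q a b : ℝ[X]) : Prop :=
  ∀ u v : ℝ, v ^ 2 + q.eval u = 0 → 0 ≤ a.eval u + b.eval u * v

/-- Among functions of pole order at most `k` at infinity, only the multiples of `a + b y` are
bounded by a multiple of it on the real points of the curve. -/
def CurveExtreme (q : ℝ[X]) (k : ℕ) (a b : ℝ[X]) : Prop :=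
  ∀ a' b' : ℝ[X], (curveNorm q a' b').natDegree ≤ 2 * k →
    (∃ c : ℝ, ∀ u v : ℝ, v ^ 2 + q.eval u = 0 →
      |a'.eval u + b'.eval u * v| ≤ c * (a.eval u + b.eval u * v)) →
    ∃ c : ℝ, a' = C c * a ∧ b' = C c * b

lemma CurveExtreme.eq_C_mul {q : ℝ[X]} (hmonic : q.Monic) (hdeg : q.natDegree = 4) {α β : ℝ}
    (hαβ : ∀ x, q.eval x = 0 → α ≤ x ∧ x ≤ β) {k : ℕ} {a b : ℝ[X]}
    (hN : curveNorm q a b ≠ 0) (hpsd : CurveNonneg q a b) (hext : CurveExtreme q k a b)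
    {p r e a' b' : ℝ[X]} (hp : ∀ u, q.eval u ≤ 0 → p.eval u ≠ 0)
    (h1 : a * r - q * b * e = p * a') (h2 : a * e + b * r = p * b')
    (hk : (curveNorm q a' b').natDegree ≤ 2 * k) : (∃ c : ℝ, r = C c * p) ∧ e = 0 := by
  have hp' : ∀ w ∈ {w : ℝ × ℝ | w.2 ^ 2 + q.eval w.1 = 0}, p.eval w.1 ≠ 0 := fun w hw => by
    simp only [Set.mem_ofPred_eq] at hw
    exact hp _ (by nlinarith [sq_nonneg w.2])
  obtain ⟨c, hc⟩ := (isCompact_curve hmonic hdeg hαβ).exists_bound_of_continuousOn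
    (f := fun w => (r.eval w.1 + e.eval w.1 * w.2) / p.eval w.1) (by
      have := r.continuous
      have := e.continuous
      have := p.continuous
      exact ContinuousOn.div (by fun_prop) (by fun_prop) hp')
  obtain ⟨c', rfl, rfl⟩ := hext a' b' hk ⟨c, fun u v huv => by
    have h3 := hc (u, v) huv
    have h4 := hp' (u, v) huv
    have h5 := congrArg (eval u) h1
    have h6 := congrArg (eval u) h2
    simp only [eval_add, eval_sub, eval_mul] at h5 h6
    have h7 : a'.eval u + b'.eval u * v =
        (r.eval u + e.eval u * v) / p.eval u * (a.eval u + b.eval u * v) := by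
      rw [div_mul_eq_mul_div, eq_div_iff h4]
      linear_combination -h5 - v * h6 - b.eval u * e.eval u * huv
    rw [h7, abs_mul, abs_of_nonneg (hpsd u v huv)]
    exact mul_le_mul_of_nonneg_right h3 (hpsd u v huv)⟩
  have h3 : curveNorm q a b * curveNorm q (r - C c' * p) e = 0 := by
    rw [← curveNorm_mul, show a * (r - C c' * p) - q * b * e = 0 by linear_combination h1,
      show a * e + b * (r - C c' * p) = 0 by linear_combination h2]
    simp [curveNorm]
  obtain ⟨h4, h5⟩ := curveNorm_eq_zero hmonic hdeg ((mul_eq_zero.1 h3).resolve_left hN)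
  exact ⟨⟨c', sub_eq_zero.1 h4⟩, h5⟩

lemma CurveExtreme.natDegree_curveNorm {q : ℝ[X]} (hmonic : q.Monic) (hdeg : q.natDegree = 4)
    {α β : ℝ} (hαβ : ∀ x, q.eval x = 0 → α ≤ x ∧ x ≤ β) {k : ℕ} {a b : ℝ[X]}
    (hN : curveNorm q a b ≠ 0) (hpsd : CurveNonneg q a b) (hext : CurveExtreme q k a b)
    (hk : (curveNorm q a b).natDegree ≤ 2 * k) : (curveNorm q a b).natDegree = 2 * k := by
  by_contra hne
  obtain ⟨n, hn⟩ := even_natDegree_curveNorm hmonic hdeg a b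
  obtain ⟨⟨c, hc⟩, -⟩ := hext.eq_C_mul hmonic hdeg hαβ hN hpsd (p := 1) (r := X) (e := 0)
    (a' := X * a) (b' := X * b) (by simp) (by ring) (by ring) (by
      rw [curveNorm_C_mul, natDegree_mul (pow_ne_zero _ X_ne_zero) hN, natDegree_X_pow]
      omega)
  have := congrArg natDegree hc
  simp at this

lemma CurveExtreme.exists_X_sub_C_dvd {q : ℝ[X]} (hmonic : q.Monic) (hdeg : q.natDegree = 4)
    {α β : ℝ} (hαβ : ∀ x, q.eval x = 0 → α ≤ x ∧ x ≤ β) {k : ℕ} {a b : ℝ[X]}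
    (hN : curveNorm q a b ≠ 0) (hpsd : CurveNonneg q a b) (hext : CurveExtreme q k a b)
    (hk : (curveNorm q a b).natDegree ≤ 2 * k) {p : ℝ[X]} (hp : Irreducible p)
    (hpN : p ∣ curveNorm q a b) : ∃ s, q.eval s ≤ 0 ∧ X - C s ∣ p := by
  by_contra! hns
  have hp' : ∀ u, q.eval u ≤ 0 → p.eval u ≠ 0 := fun u hu h => hns u hu (dvd_iff_isRoot.2 h)
  have hp0 := hp.ne_zero
  by_cases hpb : p ∣ b
  · have hpa : p ∣ a := by
      refine hp.prime.dvd_of_dvd_pow (n := 2) ?_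
      have : p ∣ q * b ^ 2 := (dvd_pow hpb two_ne_zero).mul_left q
      exact (dvd_add_left this).1 hpN
    obtain ⟨a', rfl⟩ := hpa
    obtain ⟨b', rfl⟩ := hpb
    rw [curveNorm_C_mul] at hN
    obtain ⟨⟨c, hc⟩, -⟩ := hext.eq_C_mul hmonic hdeg hαβ (by rwa [curveNorm_C_mul]) hpsd hp'
      (r := 1) (e := 0) (a' := a') (b' := b') (by ring) (by ring) (by
        rw [curveNorm_C_mul, natDegree_mul (left_ne_zero_of_mul hN) (right_ne_zero_of_mul hN)] at hk
        omega)
    exact hp.not_isUnit (.of_mul_eq_one (C c) (by rw [mul_comm, ← hc]))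
  · have hdeg2 : p.degree = 2 := by
      have h2 := hp.degree_le_two
      have h0 := degree_pos_of_irreducible hp
      rw [degree_eq_natDegree hp0] at h2 h0 ⊢
      norm_cast at h2 h0 ⊢
      by_contra hne
      obtain ⟨s, hs⟩ := exists_root_of_degree_eq_one (p := p)
        (by rw [degree_eq_natDegree hp0]; norm_cast; omega)
      have h3 : (curveNorm q a b).eval s = 0 := dvd_iff_isRoot.1 ((dvd_iff_isRoot.2 hs).trans hpN)
      have h4 : 0 < q.eval s := by
        by_contra! h
        exact hns s h (dvd_iff_isRoot.2 hs)
      simp only [curveNorm, eval_add, eval_mul, eval_pow] at h3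
      have h5 : b.eval s = 0 := by
        have : 0 ≤ q.eval s * b.eval s ^ 2 := by positivity
        have : q.eval s * b.eval s ^ 2 = 0 := by nlinarith [sq_nonneg (a.eval s)]
        simpa [h4.ne'] using this
      exact hpb (((irreducible_X_sub_C s).associated_of_dvd hp
        (dvd_iff_isRoot.2 hs)).symm.dvd.trans (dvd_iff_isRoot.2 h5))
    have hco : IsCoprime p b := (hp.coprime_iff_not_dvd).2 hpb
    obtain ⟨x, y, hxy⟩ := hco
    set r := (-(a * y)) % p with hr
    have hr1 : p ∣ r + a * y := by
      have := EuclideanDomain.div_add_mod (-(a * y)) p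
      exact ⟨-(-(a * y) / p), by rw [hr]; linear_combination this⟩
    obtain ⟨t, ht⟩ := hr1
    have hrd : r.degree < 2 := hdeg2 ▸ EuclideanDomain.mod_lt (-(a * y)) hp0
    obtain ⟨b', hb'⟩ : p ∣ a * 1 + b * r := ⟨b * t + a * x, by
      linear_combination b * ht - a * hxy⟩
    obtain ⟨a', ha'⟩ : p ∣ a * r - q * b * 1 := by
      refine (hp.prime.dvd_or_dvd (a := b) ?_).resolve_left hpb
      obtain ⟨n, hn⟩ := hpN
      unfold curveNorm at hn
      exact ⟨a * b' - n, by linear_combination a * hb' - hn⟩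
    have hnorm : p ^ 2 * curveNorm q a' b' = curveNorm q a b * curveNorm q r 1 := by
      rw [← curveNorm_C_mul, ← curveNorm_mul, ha', hb']
    have hr0 : curveNorm q r 1 ≠ 0 := fun h => one_ne_zero (curveNorm_eq_zero hmonic hdeg h).2
    have h0 : curveNorm q a' b' ≠ 0 := right_ne_zero_of_mul (hnorm ▸ mul_ne_zero hN hr0)
    have hd := congrArg natDegree hnorm
    rw [natDegree_mul (pow_ne_zero _ hp0) h0, natDegree_mul hN hr0, natDegree_pow,
      natDegree_eq_of_degree_eq_some (n := 2) hdeg2] at hd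
    have hr2 : (curveNorm q r 1).natDegree ≤ 2 * 2 := by
      rw [natDegree_curveNorm_le_iff hmonic hdeg]
      exact ⟨natDegree_le_of_degree_le hrd.le, by simp⟩
    obtain ⟨-, h⟩ := hext.eq_C_mul hmonic hdeg hαβ hN hpsd hp' ha' hb' (by omega)
    exact one_ne_zero h

/-- A factorization `q = Q Q'` such that `2 Q (a + b y) = (Q M + B y) ^ 2` on the curve
`y ^ 2 + q(x) = 0`, with `Q` nonnegative wherever `q` is negative. -/
structure CurveDescent (q a b Q Q' M B : ℝ[X]) : Prop where
  mul_eq : Q * Q' = q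
  two_mul_eq : C 2 * a = Q * M ^ 2 - Q' * B ^ 2
  eq_mul : b = M * B
  nonneg : ∀ u, q.eval u < 0 → 0 ≤ Q.eval u

lemma CurveDescent.swap {q a b Q Q' M B : ℝ[X]} (h : CurveDescent q a b Q Q' M B) :
    CurveDescent q a b (-Q') (-Q) B M where
  mul_eq := by rw [← h.mul_eq]; ring
  two_mul_eq := by rw [h.two_mul_eq]; ring
  eq_mul := by rw [h.eq_mul]; ring
  nonneg := fun u hu => by
    have h1 := h.nonneg u hu
    rw [← h.mul_eq, eval_mul] at hu
    rw [eval_neg]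
    by_contra! h2
    nlinarith

lemma CurveDescent.sq_fst {q a b Q Q' M B : ℝ[X]} (h : CurveDescent q a b Q Q' M B) :
    C 2 * Q * a = (Q * M) ^ 2 - q * B ^ 2 := by
  rw [← h.mul_eq]; linear_combination Q * h.two_mul_eq

lemma CurveDescent.sq_snd {q a b Q Q' M B : ℝ[X]} (h : CurveDescent q a b Q Q' M B) :
    C 2 * Q * b = 2 * (Q * M) * B := by
  rw [h.eq_mul, show (C 2 : ℝ[X]) = 2 from rfl]; ring

lemma curveNorm_sq_of_sq_eq {q a b Q A B : ℝ[X]} (h1 : Q * a = A ^ 2 - q * B ^ 2)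
    (h2 : Q * b = 2 * A * B) : Q ^ 2 * curveNorm q a b = curveNorm q A B ^ 2 := by
  rw [← curveNorm_C_mul, h1, h2, curveNorm, curveNorm]; ring

lemma CurveDescent.even_natDegree {q a b Q Q' M B : ℝ[X]} (hmonic : q.Monic)
    (hdeg : q.natDegree = 4) (h : CurveDescent q a b Q Q' M B) {d : ℕ}
    (hN : curveNorm q a b ≠ 0) (hd : (curveNorm q a b).natDegree = 4 * d) : Even Q.natDegree := by
  have h1 := curveNorm_sq_of_sq_eq h.sq_fst h.sq_snd
  have hQ : Q ≠ 0 := by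
    rintro rfl
    exact hmonic.ne_zero (by simpa using h.mul_eq.symm)
  have h2 := congrArg natDegree h1
  have h3 : C (2 : ℝ) ≠ 0 := C_ne_zero.2 two_ne_zero
  rw [natDegree_mul (pow_ne_zero _ (mul_ne_zero h3 hQ)) hN, natDegree_pow, natDegree_pow,
    natDegree_C_mul two_ne_zero, hd] at h2
  obtain ⟨n, hn⟩ := even_natDegree_curveNorm hmonic hdeg (Q * M) B
  exact ⟨n - d, by omega⟩

lemma CurveNonneg.curveNorm_eval_nonneg {q a b : ℝ[X]} (h : CurveNonneg q a b) (u : ℝ) :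
    0 ≤ (curveNorm q a b).eval u := by
  simp only [curveNorm, eval_add, eval_mul, eval_pow]
  rcases le_or_gt 0 (q.eval u) with hu | hu
  · positivity
  · have hv : √(-q.eval u) ^ 2 = -q.eval u := Real.sq_sqrt (by linarith)
    have h1 := h u (√(-q.eval u)) (by rw [hv]; ring)
    have h2 := h u (-√(-q.eval u)) (by rw [neg_sq, hv]; ring)
    have h3 := mul_nonneg h1 h2
    linear_combination h3 - b.eval u ^ 2 * hv

lemma CurveNonneg.eval_fst_nonneg {q a b : ℝ[X]} (h : CurveNonneg q a b) {u : ℝ}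
    (hu : q.eval u ≤ 0) : 0 ≤ a.eval u := by
  have hv : √(-q.eval u) ^ 2 = -q.eval u := Real.sq_sqrt (by linarith)
  have h1 := h u (√(-q.eval u)) (by rw [hv]; ring)
  have h2 := h u (-√(-q.eval u)) (by rw [neg_sq, hv]; ring)
  linarith

lemma CurveNonneg.exists_curveDescent {q a b : ℝ[X]} (hmonic : q.Monic) (hdeg : q.natDegree = 4)
    (hsq : Squarefree q) (hpsd : CurveNonneg q a b) (hN : curveNorm q a b ≠ 0)
    (hirr : ∀ p, Irreducible p → p ∣ curveNorm q a b → ∃ s, q.eval s ≤ 0 ∧ X - C s ∣ p) :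
    ∃ Q Q' M B, CurveDescent q a b Q Q' M B := by
  obtain ⟨K, hK, hH⟩ : ∃ K, curveNorm q a b = K ^ 2 ∧ K + a ≠ 0 := by
    obtain ⟨K, hK⟩ := exists_sq_of_nonneg_of_linear hN hpsd.curveNorm_eval_nonneg
      (fun p hp hpN => (hirr p hp hpN).imp fun s hs => hs.2)
    by_cases h : K + a = 0
    · refine ⟨-K, by rw [hK]; ring, fun h' => hN ?_⟩
      have h2 : (2 : ℝ[X]) * K = 0 := by linear_combination h - h'
      have : K = 0 := (mul_eq_zero.1 h2).resolve_left two_ne_zero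
      rw [hK, this]; ring
    · exact ⟨K, hK, h⟩
  obtain ⟨Q, M, hQM, hQ⟩ := exists_squarefree_mul_sq hH
  have hM : M ≠ 0 := by
    rintro rfl
    exact hH (by rw [hQM]; ring)
  have hK' : (K + a) * (K - a) = q * b ^ 2 := by
    unfold curveNorm at hK; linear_combination -hK
  have hHnonneg : ∀ u, q.eval u ≤ 0 → 0 ≤ (K + a).eval u := fun u hu => by
    have h1 := hpsd.eval_fst_nonneg hu
    have h2 := congrArg (eval u) hK
    simp only [curveNorm, eval_add, eval_mul, eval_pow] at h2 ⊢
    have h3 : K.eval u ^ 2 ≤ a.eval u ^ 2 := by nlinarith [sq_nonneg (b.eval u)]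
    linarith [(abs_le.1 (abs_le_of_sq_le_sq h3 h1)).1]
  have hQnonneg : ∀ u, q.eval u < 0 → 0 ≤ Q.eval u := fun u hu => by
    by_contra! hneg
    have h1 : ∀ᶠ x in nhds u, q.eval x < 0 := q.continuous.continuousAt.eventually_lt_const hu
    have h2 : ∀ᶠ x in nhds u, Q.eval x < 0 := Q.continuous.continuousAt.eventually_lt_const hneg
    refine hM (eq_zero_of_infinite_isRoot M (infinite_of_mem_nhds u ?_))
    filter_upwards [h1, h2] with x hx1 hx2
    have h3 := hHnonneg x hx1.le
    rw [hQM, eval_mul, eval_pow] at h3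
    have h4 : M.eval x ^ 2 = 0 := by
      refine le_antisymm ?_ (sq_nonneg _)
      by_contra! h5
      nlinarith
    exact pow_eq_zero_iff two_ne_zero |>.1 h4
  have hQq : Q ∣ q := by
    refine hQ.dvd_of_forall_irreducible_dvd fun p hp hpQ => ?_
    have hpH : p ∣ K + a := hQM ▸ hpQ.mul_right _
    by_contra hpq
    have hpK : p ∣ K := by
      by_contra hpK
      have hpKa : ¬ p ∣ K - a := fun h => by
        have h2 : p ∣ C 2 * K := by
          have := dvd_add hpH h
          rwa [show K + a + (K - a) = C 2 * K by rw [show (C 2 : ℝ[X]) = 2 from rfl]; ring] at this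
        rcases hp.prime.dvd_or_dvd h2 with h3 | h3
        · exact hp.not_isUnit (isUnit_of_dvd_unit h3 (isUnit_C.2 (isUnit_iff_ne_zero.2 two_ne_zero)))
        · exact hpK h3
      have hb : b ≠ 0 := by
        rintro rfl
        have : K - a = 0 := (mul_eq_zero.1 (by rw [hK']; ring)).resolve_left hH
        exact hpKa (this ▸ dvd_zero p)
      exact not_dvd_of_squarefree_mul_sq hp hQ hpKa hpq hb (by rw [← hQM, hK']) hpQ
    obtain ⟨s, hs, hsp⟩ := hirr p hp (hK ▸ dvd_pow hpK two_ne_zero)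
    have hsp' := ((irreducible_X_sub_C s).associated_of_dvd hp hsp).symm.dvd
    rcases hs.lt_or_eq with hs | hs
    · have h1 : ∀ᶠ x in nhds s, q.eval x < 0 := q.continuous.continuousAt.eventually_lt_const hs
      have h2 := X_sub_C_sq_dvd_of_nonneg (dvd_iff_isRoot.1 (hsp.trans hpQ)) (h1.mono hQnonneg)
      rw [pow_two] at h2
      exact not_isUnit_X_sub_C s (hQ _ h2)
    · exact hpq (hsp'.trans (dvd_iff_isRoot.2 hs))
  obtain ⟨Q', rfl⟩ := hQq
  obtain ⟨B, rfl⟩ : M ∣ b := by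
    refine hsq.dvd_of_sq_dvd_mul_sq ?_
    rw [← hK', hQM]
    exact (dvd_mul_left _ _).mul_right _
  refine ⟨Q, Q', M, B, rfl, ?_, rfl, hQnonneg⟩
  rw [hQM] at hK'
  have h1 : K - a = Q' * B ^ 2 := by
    refine mul_left_cancel₀ (mul_ne_zero hQ.ne_zero (pow_ne_zero 2 hM)) ?_
    rw [hK']; ring
  rw [show (C 2 : ℝ[X]) = 2 from rfl]
  linear_combination hQM - h1

lemma CurveDescent.exists_sq_of_natDegree_eq_zero {q a b Q Q' M B : ℝ[X]} (hmonic : q.Monic)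
    (hindef : ∃ x, q.eval x < 0) (h : CurveDescent q a b Q Q' M B) (hQ : Q.natDegree = 0) :
    ∃ (c : ℝ) (A B : ℝ[X]), 0 < c ∧ C c * a = A ^ 2 - q * B ^ 2 ∧ C c * b = 2 * A * B := by
  obtain ⟨k, rfl⟩ := natDegree_eq_zero.1 hQ
  obtain ⟨u, hu⟩ := hindef
  have hk : 0 ≤ k := by simpa using h.nonneg u hu
  have hk0 : k ≠ 0 := by
    rintro rfl
    exact hmonic.ne_zero (by simpa using h.mul_eq.symm)
  refine ⟨2 * k, C k * M, B, by positivity, ?_, ?_⟩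
  · rw [C_mul, h.sq_fst]
  · rw [C_mul, h.sq_snd]

lemma CurveDescent.exists_sq_of_natDegree_eq_two {q a b Q Q' M B : ℝ[X]} (hmonic : q.Monic)
    (hdeg : q.natDegree = 4) (hsq : Squarefree q) (hindef : ∃ x, q.eval x < 0) {α β : ℝ}
    (hα : q.eval α = 0) (hβ : q.eval β = 0) (hαβ : ∀ x, q.eval x = 0 → α ≤ x ∧ x ≤ β)
    (h : CurveDescent q a b Q Q' M B) (hQ : Q.natDegree = 2) (hQα : Q.eval α = 0) :
    ∃ (c : ℝ) (A B : ℝ[X]), 0 < c ∧ C c * ((X - C α) * (C β - X)) * a = A ^ 2 - q * B ^ 2 ∧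
      C c * ((X - C α) * (C β - X)) * b = 2 * A * B := by
  have hmem : ∀ u, q.eval u < 0 → α < u ∧ u < β := fun u hu => by
    obtain ⟨h1, h2⟩ := mem_Icc_of_eval_nonpos hmonic hdeg hαβ hu.le
    refine ⟨lt_of_le_of_ne h1 ?_, lt_of_le_of_ne h2 ?_⟩
    · rintro rfl; linarith
    · rintro rfl; linarith
  obtain ⟨R, rfl⟩ := dvd_iff_isRoot.2 hQα
  have hR0 : R ≠ 0 := by rintro rfl; simp at hQ
  rw [natDegree_mul (X_sub_C_ne_zero α) hR0, natDegree_X_sub_C] at hQ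
  obtain ⟨t, ht⟩ := exists_root_of_degree_eq_one (p := R)
    (by rw [degree_eq_natDegree hR0]; norm_cast; omega)
  obtain ⟨S, rfl⟩ := dvd_iff_isRoot.2 ht
  have hS0 : S ≠ 0 := right_ne_zero_of_mul hR0
  rw [natDegree_mul (X_sub_C_ne_zero t) hS0, natDegree_X_sub_C] at hQ
  obtain ⟨k, rfl⟩ := natDegree_eq_zero.1 (show S.natDegree = 0 by omega)
  have hk : k ≠ 0 := by rintro rfl; simp at hS0
  have hqt : q.eval t = 0 := by rw [← h.mul_eq]; simp
  have hαt : α < t := by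
    refine lt_of_le_of_ne (hαβ t hqt).1 ?_
    rintro rfl
    exact not_isUnit_X_sub_C α (hsq _ ⟨C k * Q', by rw [← h.mul_eq]; ring⟩)
  have hnonneg : ∀ u, q.eval u < 0 → 0 ≤ (u - α) * ((u - t) * k) := fun u hu => by
    simpa using h.nonneg u hu
  have htβ : t = β := by
    refine le_antisymm (hαβ t hqt).2 ?_
    by_contra! htβ
    obtain ⟨u, hu, hut⟩ := ((frequently_eval_neg hsq hα).and_eventually
      (eventually_lt_nhds hαt)).exists
    obtain ⟨w, hw, hwt⟩ := ((frequently_eval_neg hsq hβ).and_eventually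
      (eventually_gt_nhds htβ)).exists
    have h1 := nonneg_of_mul_nonneg_right (hnonneg u hu) (sub_pos.2 (hmem u hu).1)
    have h2 := nonneg_of_mul_nonneg_right (hnonneg w hw) (sub_pos.2 (hmem w hw).1)
    have h3 : 0 ≤ k := nonneg_of_mul_nonneg_right h2 (by linarith)
    have h4 : 0 < k := lt_of_le_of_ne h3 hk.symm
    nlinarith
  subst htβ
  obtain ⟨u, hu⟩ := hindef
  have h1 := nonneg_of_mul_nonneg_right (hnonneg u hu) (sub_pos.2 (hmem u hu).1)
  have h2 : k < 0 := by
    refine lt_of_le_of_ne ?_ hk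
    by_contra! h3
    nlinarith [(hmem u hu).2]
  refine ⟨-(2 * k), (X - C α) * ((X - C t) * C k) * M, B, by linarith, ?_, ?_⟩
  · rw [← h.sq_fst, C_neg, C_mul]; ring
  · rw [← h.sq_snd, C_neg, C_mul]; ring

lemma CurveDescent.exists_sq {q a b Q Q' M B : ℝ[X]} (hmonic : q.Monic)
    (hdeg : q.natDegree = 4) (hsq : Squarefree q) (hindef : ∃ x, q.eval x < 0) {α β : ℝ}
    (hα : q.eval α = 0) (hβ : q.eval β = 0) (hαβ : ∀ x, q.eval x = 0 → α ≤ x ∧ x ≤ β)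
    (h : CurveDescent q a b Q Q' M B) {d : ℕ}
    (hN : curveNorm q a b ≠ 0) (hd : (curveNorm q a b).natDegree = 4 * d) :
    ∃ (c : ℝ) (A B : ℝ[X]), 0 < c ∧
      ((C c * a = A ^ 2 - q * B ^ 2 ∧ C c * b = 2 * A * B) ∨
        (C c * ((X - C α) * (C β - X)) * a = A ^ 2 - q * B ^ 2 ∧
          C c * ((X - C α) * (C β - X)) * b = 2 * A * B)) := by
  wlog hQα : Q.eval α = 0 generalizing Q Q' M B
  · refine this h.swap ?_
    have := congrArg (eval α) h.mul_eq
    rw [eval_mul, hα] at this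
    simpa using (mul_eq_zero.1 this).resolve_left hQα
  have h0 : Q * Q' ≠ 0 := h.mul_eq ▸ hmonic.ne_zero
  have hQQ' := congrArg natDegree h.mul_eq
  rw [natDegree_mul (left_ne_zero_of_mul h0) (right_ne_zero_of_mul h0), hdeg] at hQQ'
  obtain ⟨n, hn⟩ := h.even_natDegree hmonic hdeg hN hd
  have hpos : Q.natDegree ≠ 0 := by
    intro hz
    obtain ⟨k, rfl⟩ := natDegree_eq_zero.1 hz
    have : k = 0 := by simpa using hQα
    simp [this] at h0
  rcases (show Q.natDegree = 2 ∨ Q'.natDegree = 0 by omega) with h2 | h2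
  · obtain ⟨c, A, B, hc, h3⟩ := h.exists_sq_of_natDegree_eq_two hmonic hdeg hsq hindef hα hβ hαβ
      h2 hQα
    exact ⟨c, A, B, hc, .inr h3⟩
  · obtain ⟨c, A, B, hc, h3⟩ := h.swap.exists_sq_of_natDegree_eq_zero hmonic hindef (by simpa)
    exact ⟨c, A, B, hc, .inl h3⟩

/-- `a + b y` is a sum of squares of functions of pole order at most `k` at infinity on the
curve `y² + q(x) = 0`. -/
def CurveSos (q : ℝ[X]) (k : ℕ) (a b : ℝ[X]) : Prop :=
  ∃ (m : ℕ) (A B : Fin m → ℝ[X]), (∀ i, (curveNorm q (A i) (B i)).natDegree ≤ 2 * k) ∧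
    a = ∑ i, (A i ^ 2 - q * B i ^ 2) ∧ b = ∑ i, 2 * A i * B i

lemma CurveSos.zero (q : ℝ[X]) (k : ℕ) : CurveSos q k 0 0 :=
  ⟨0, Fin.elim0, Fin.elim0, fun i => i.elim0, by simp, by simp⟩

lemma CurveSos.add {q : ℝ[X]} {k : ℕ} {a b a' b' : ℝ[X]} (h : CurveSos q k a b)
    (h' : CurveSos q k a' b') : CurveSos q k (a + a') (b + b') := by
  obtain ⟨m, A, B, h1, h2, h3⟩ := h
  obtain ⟨m', A', B', h1', h2', h3'⟩ := h'
  refine ⟨m + m', Fin.append A A', Fin.append B B', fun i => ?_, ?_, ?_⟩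
  · induction i using Fin.addCases with
    | left i => simpa using h1 i
    | right i => simpa using h1' i
  · simp only [Fin.sum_univ_add, Fin.append_left, Fin.append_right, h2, h2']
  · simp only [Fin.sum_univ_add, Fin.append_left, Fin.append_right, h3, h3']

lemma CurveSos.of_C_mul {q : ℝ[X]} {k : ℕ} {a b : ℝ[X]} {c : ℝ} (hc : 0 < c)
    (h : CurveSos q k (C c * a) (C c * b)) : CurveSos q k a b := by
  obtain ⟨m, A, B, h1, h2, h3⟩ := h
  have hs : (C (√c)⁻¹ : ℝ[X]) ^ 2 * C c = 1 := by
    rw [← C_pow, ← C_mul, inv_pow, Real.sq_sqrt hc.le, inv_mul_cancel₀ hc.ne', C_1]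
  refine ⟨m, fun i => C (√c)⁻¹ * A i, fun i => C (√c)⁻¹ * B i, fun i => ?_, ?_, ?_⟩
  · rw [curveNorm_C_mul, ← C_pow]
    exact (natDegree_C_mul_le _ _).trans (h1 i)
  · calc a = (C (√c)⁻¹ : ℝ[X]) ^ 2 * (C c * a) := by rw [← mul_assoc, hs, one_mul]
      _ = _ := by
        rw [h2, Finset.mul_sum]
        exact Finset.sum_congr rfl fun i _ => by ring
  · calc b = (C (√c)⁻¹ : ℝ[X]) ^ 2 * (C c * b) := by rw [← mul_assoc, hs, one_mul]
      _ = _ := by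
        rw [h3, Finset.mul_sum]
        exact Finset.sum_congr rfl fun i _ => by ring

lemma CurveSos.of_sq {q : ℝ[X]} {k : ℕ} {a b A B : ℝ[X]} {c : ℝ} (hc : 0 < c)
    (h1 : C c * a = A ^ 2 - q * B ^ 2) (h2 : C c * b = 2 * A * B)
    (hk : (curveNorm q a b).natDegree ≤ 4 * k) : CurveSos q k a b := by
  refine CurveSos.of_C_mul hc ⟨1, fun _ => A, fun _ => B, fun _ => ?_, by simpa, by simpa⟩
  have h := congrArg natDegree (curveNorm_sq_of_sq_eq h1 h2)
  rw [natDegree_pow, ← C_pow, natDegree_C_mul (pow_ne_zero _ hc.ne')] at h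
  beta_reduce
  omega

lemma mul_X_sub_C_dvd {p : ℝ[X]} {α β : ℝ} (hne : α ≠ β) (hα : p.eval α = 0)
    (hβ : p.eval β = 0) : (X - C α) * (C β - X) ∣ p := by
  obtain ⟨r, rfl⟩ := dvd_iff_isRoot.2 hα
  rw [eval_mul] at hβ
  obtain ⟨s, rfl⟩ := dvd_iff_isRoot.2 ((mul_eq_zero.1 hβ).resolve_left (by
    simpa [sub_eq_zero] using hne.symm))
  exact ⟨-s, by ring⟩

lemma CurveSos.of_mul_sq {q : ℝ[X]} {α β : ℝ}
    (hne : α ≠ β) (hα : q.eval α = 0) (hβ : q.eval β = 0)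
    {N : ℕ} (hN : 2 ≤ N) (hsos : CurveSos q N ((X - C α) * (C β - X)) 0)
    {d : ℕ} {a b A B : ℝ[X]} {c : ℝ} (hc : 0 < c)
    (h1 : C c * ((X - C α) * (C β - X)) * a = A ^ 2 - q * B ^ 2)
    (h2 : C c * ((X - C α) * (C β - X)) * b = 2 * A * B)
    (hab : curveNorm q a b ≠ 0)
    (hk : (curveNorm q a b).natDegree ≤ 4 * d) : CurveSos q (N + d - 1) a b := by
  obtain ⟨m, A', B', hA', hl, h0⟩ := hsos
  set l : ℝ[X] := (X - C α) * (C β - X) with hldef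
  have hd2 : l.natDegree = 2 := by
    rw [hldef]; compute_degree!
  have hl0 : l ≠ 0 := by rintro h; simp [h] at hd2
  have hlα : l.eval α = 0 := by simp [hldef]
  have hlβ : l.eval β = 0 := by simp [hldef]
  have hA : ∀ s, q.eval s = 0 → l.eval s = 0 → A.eval s = 0 := fun s hs hs' => by
    have := congrArg (eval s) h1
    simpa [hs, hs'] using this.symm
  have hA's : ∀ s, q.eval s = 0 → l.eval s = 0 → ∀ i, (A' i).eval s = 0 := fun s hs hs' i => by
    have := congrArg (eval s) hl
    rw [hs', eval_finsetSum] at this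
    simp only [eval_sub, eval_pow, eval_mul, hs, zero_mul, sub_zero] at this
    exact pow_eq_zero_iff two_ne_zero |>.1
      ((Finset.sum_eq_zero_iff_of_nonneg fun i _ => sq_nonneg _).1 this.symm i (Finset.mem_univ i))
  obtain ⟨R, hR⟩ := mul_X_sub_C_dvd hne (hA α hα hlα) (hA β hβ hlβ)
  obtain ⟨T, hT⟩ := mul_X_sub_C_dvd hne hα hβ
  choose S hS using fun i => mul_X_sub_C_dvd hne (hA's α hα hlα i) (hA's β hβ hlβ i)
  rw [← hldef] at hR hT
  simp only [← hldef] at hS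
  have x1 : ∀ i, l * (A * S i - T * B * B' i) = A * A' i - q * B * B' i := fun i => by
    linear_combination -A * hS i + B * B' i * hT
  have x2 : ∀ i, l * (R * B' i + B * S i) = A * B' i + B * A' i := fun i => by
    linear_combination -B' i * hR - B * hS i
  refine CurveSos.of_C_mul hc ⟨m, fun i => A * S i - T * B * B' i, fun i => R * B' i + B * S i,
    fun i => ?_, ?_, ?_⟩
  · beta_reduce
    have e1 : l ^ 2 * curveNorm q (A * S i - T * B * B' i) (R * B' i + B * S i) =
        curveNorm q A B * curveNorm q (A' i) (B' i) := by
      rw [← curveNorm_C_mul, ← curveNorm_mul]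
      rw [x1, x2]
    have e2 := congrArg natDegree (curveNorm_sq_of_sq_eq h1 h2)
    rw [natDegree_pow, mul_pow, ← C_pow, mul_assoc, natDegree_C_mul (pow_ne_zero _ hc.ne'),
      natDegree_mul (pow_ne_zero _ hl0) hab, natDegree_pow, hd2] at e2
    by_cases hz : curveNorm q (A * S i - T * B * B' i) (R * B' i + B * S i) = 0
    · simp [hz]
    have e3 := congrArg natDegree e1
    rw [natDegree_mul (pow_ne_zero _ hl0) hz, natDegree_pow, hd2] at e3
    have e4 := (curveNorm q A B).natDegree_mul_le (q := curveNorm q (A' i) (B' i))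
    have := hA' i
    omega
  · refine mul_left_cancel₀ (pow_ne_zero 2 hl0) ?_
    calc l ^ 2 * (C c * a) = l * (C c * l * a) + 0 * (- 2 * q * A * B) := by ring
      _ = _ := by
        rw [h1, h0]
        nth_rewrite 1 [hl]
        rw [Finset.sum_mul, Finset.sum_mul, Finset.mul_sum, ← Finset.sum_add_distrib]
        refine Finset.sum_congr rfl fun i _ => ?_
        linear_combination (-(l * (A * S i - T * B * B' i)) - (A * A' i - q * B * B' i)) * x1 i +
          q * (l * (R * B' i + B * S i) + (A * B' i + B * A' i)) * x2 i
  · refine mul_left_cancel₀ (pow_ne_zero 2 hl0) ?_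
    calc l ^ 2 * (C c * b) = l * (C c * l * b) + 0 * (A ^ 2 - q * B ^ 2) := by ring
      _ = _ := by
        rw [h2, h0]
        nth_rewrite 1 [hl]
        rw [Finset.sum_mul, Finset.sum_mul, Finset.mul_sum, ← Finset.sum_add_distrib]
        refine Finset.sum_congr rfl fun i _ => ?_
        linear_combination -2 * (l * (R * B' i + B * S i)) * x1 i -
          2 * (A * A' i - q * B * B' i) * x2 i

lemma CurveExtreme.curveSos {q : ℝ[X]} (hmonic : q.Monic) (hdeg : q.natDegree = 4)
    (hsq : Squarefree q) (hindef : ∃ x, q.eval x < 0) {α β : ℝ}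
    (hα : q.eval α = 0) (hβ : q.eval β = 0) (hαβ : ∀ x, q.eval x = 0 → α ≤ x ∧ x ≤ β)
    {N : ℕ} (hN : 2 ≤ N) (hsos : CurveSos q N ((X - C α) * (C β - X)) 0) {d : ℕ} {a b : ℝ[X]}
    (hab : curveNorm q a b ≠ 0) (hpsd : CurveNonneg q a b) (hext : CurveExtreme q (2 * d) a b)
    (hk : (curveNorm q a b).natDegree ≤ 2 * (2 * d)) : CurveSos q (N + d - 1) a b := by
  have hd : (curveNorm q a b).natDegree = 4 * d := by
    rw [hext.natDegree_curveNorm hmonic hdeg hαβ hab hpsd hk]; ring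
  have hne : α ≠ β := by
    rintro rfl
    obtain ⟨x, hx⟩ := hindef
    obtain ⟨h1, h2⟩ := mem_Icc_of_eval_nonpos hmonic hdeg hαβ hx.le
    rw [le_antisymm h2 h1] at hx
    exact hx.ne hα
  obtain ⟨Q, Q', M, B, h⟩ := hpsd.exists_curveDescent hmonic hdeg hsq hab fun p hp hpN =>
    hext.exists_X_sub_C_dvd hmonic hdeg hαβ hab hpsd hk hp hpN
  obtain ⟨c, A, B, hc, ⟨h1, h2⟩ | ⟨h1, h2⟩⟩ :=
    h.exists_sq hmonic hdeg hsq hindef hα hβ hαβ hab hd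
  · exact CurveSos.of_sq hc h1 h2 (by omega)
  · exact CurveSos.of_mul_sq hne hα hβ hN hsos hc h1 h2 hab hd.le

lemma eq_zero_of_curve_eq_zero {q : ℝ[X]} (hindef : ∃ x, q.eval x < 0) {a b : ℝ[X]}
    (h : ∀ u v : ℝ, v ^ 2 + q.eval u = 0 → a.eval u + b.eval u * v = 0) : a = 0 ∧ b = 0 := by
  have hinf : {u | q.eval u < 0}.Infinite := by
    obtain ⟨x, hx⟩ := hindef
    exact infinite_of_mem_nhds x
      ((isOpen_lt q.continuous continuous_const).mem_nhds hx)
  have key : ∀ u ∈ {u | q.eval u < 0}, a.eval u = 0 ∧ b.eval u = 0 := fun u hu => by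
    have hu : 0 < -q.eval u := neg_pos.2 hu
    have h1 := h u (√(-q.eval u)) (by rw [Real.sq_sqrt hu.le]; ring)
    have h2 := h u (-√(-q.eval u)) (by rw [neg_sq, Real.sq_sqrt hu.le]; ring)
    refine ⟨by linarith, ?_⟩
    exact (mul_eq_zero.1 (show b.eval u * √(-q.eval u) = 0 by linarith)).resolve_right
      (Real.sqrt_pos.2 hu).ne'
  exact ⟨eq_zero_of_infinite_isRoot _ (hinf.mono fun u hu => (key u hu).1),
    eq_zero_of_infinite_isRoot _ (hinf.mono fun u hu => (key u hu).2)⟩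

/-- The restriction to the real points of `y² + q(x) = 0` of the functions `a + b y` with
`deg a ≤ k` and `deg b ≤ k - 2`. -/
def curveEval (q : ℝ[X]) (k : ℕ) :
    (degreeLT ℝ (k + 1) × degreeLT ℝ (k - 1)) →ₗ[ℝ]
      ({w : ℝ × ℝ // w.2 ^ 2 + q.eval w.1 = 0} → ℝ) where
  toFun f w := (f.1 : ℝ[X]).eval w.1.1 + (f.2 : ℝ[X]).eval w.1.1 * w.1.2
  map_add' f g := by
    ext w
    simp only [Prod.fst_add, Prod.snd_add, Submodule.coe_add, eval_add, Pi.add_apply]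
    ring
  map_smul' c f := by
    ext w
    simp only [Prod.smul_fst, Prod.smul_snd, Submodule.coe_smul, eval_smul, smul_eq_mul,
      Pi.smul_apply, RingHom.id_apply]
    ring

lemma curveEval_injective {q : ℝ[X]} (hindef : ∃ x, q.eval x < 0) (k : ℕ) :
    Function.Injective (curveEval q k) := by
  refine (injective_iff_map_eq_zero _).2 fun f hf => ?_
  obtain ⟨h1, h2⟩ := eq_zero_of_curve_eq_zero hindef (a := f.1) (b := f.2)
    fun u v huv => congrFun hf ⟨(u, v), huv⟩
  exact Prod.ext (Subtype.ext h1) (Subtype.ext h2)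

theorem CurveNonneg.curveSos {q : ℝ[X]} (hmonic : q.Monic) (hdeg : q.natDegree = 4)
    (hsq : Squarefree q) (hindef : ∃ x, q.eval x < 0) {α β : ℝ}
    (hα : q.eval α = 0) (hβ : q.eval β = 0) (hαβ : ∀ x, q.eval x = 0 → α ≤ x ∧ x ≤ β)
    {N : ℕ} (hN : 2 ≤ N) (hsos : CurveSos q N ((X - C α) * (C β - X)) 0) {d : ℕ} (hd : 1 ≤ d)
    {a b : ℝ[X]} (hpsd : CurveNonneg q a b)
    (hk : (curveNorm q a b).natDegree ≤ 2 * (2 * d)) : CurveSos q (N + d - 1) a b := by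
  have hiff : ∀ {a b : ℝ[X]}, _ := @natDegree_curveNorm_le_iff_degreeLT q hmonic hdeg
  obtain ⟨ha, hb⟩ := (hiff (k := 2 * d) (by omega)).1 hk
  refine nonneg_induction_of_extreme (curveEval q (2 * d)) (curveEval_injective hindef _)
    (P := fun f => CurveSos q (N + d - 1) f.1 f.2) (CurveSos.zero _ _)
    (fun f g hf hg => hf.add hg) (fun f hf0 hf hext => ?_) (⟨a, ha⟩, ⟨b, hb⟩)
    fun w => hpsd _ _ w.2
  refine CurveExtreme.curveSos hmonic hdeg hsq hindef hα hβ hαβ hN hsos (d := d) (fun h => hf0 ?_)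
    (fun u v huv => hf ⟨(u, v), huv⟩) (fun a' b' hab' ⟨c, hc⟩ => ?_)
    ((hiff (by omega)).2 ⟨f.1.2, f.2.2⟩)
  · obtain ⟨h1, h2⟩ := curveNorm_eq_zero hmonic hdeg h
    exact Prod.ext (Subtype.ext h1) (Subtype.ext h2)
  · obtain ⟨ha', hb'⟩ := (hiff (k := 2 * d) (by omega)).1 hab'
    obtain ⟨e, he⟩ := hext (⟨a', ha'⟩, ⟨b', hb'⟩) ⟨c, fun w => hc _ _ w.2⟩
    refine ⟨e, ?_, ?_⟩
    · simpa [smul_eq_C_mul] using congrArg (fun g => (g.1 : ℝ[X])) he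
    · simpa [smul_eq_C_mul] using congrArg (fun g => (g.2 : ℝ[X])) he

lemma mem_degreeLT_of_natDegree_lt {p : ℝ[X]} {n : ℕ} (h : p.natDegree < n) :
    p ∈ degreeLT ℝ n :=
  mem_degreeLT.2 (degree_le_natDegree.trans_lt (by exact_mod_cast h))

/-- Reduction of a bivariate polynomial of degree at most `d` modulo `y² + q(x)`. -/
lemma exists_curve_reduction {q : ℝ[X]} (hdeg : q.natDegree = 4) {d : ℕ}
    {p : MvPolynomial (Fin 2) ℝ} (hp : p.totalDegree ≤ d) :
    ∃ a ∈ degreeLT ℝ (2 * d + 1), ∃ b ∈ degreeLT ℝ (2 * d - 1),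
      (MvPolynomial.X 1 : MvPolynomial (Fin 2) ℝ) ^ 2 + Polynomial.aeval (MvPolynomial.X 0) q ∣
        p - (Polynomial.aeval (MvPolynomial.X 0) a +
          Polynomial.aeval (MvPolynomial.X 0) b * MvPolynomial.X 1) := by
  rw [p.as_sum]
  refine Finset.sum_induction _ (fun p : MvPolynomial (Fin 2) ℝ =>
    ∃ a ∈ degreeLT ℝ (2 * d + 1), ∃ b ∈ degreeLT ℝ (2 * d - 1),
      (MvPolynomial.X 1 : MvPolynomial (Fin 2) ℝ) ^ 2 + Polynomial.aeval (MvPolynomial.X 0) q ∣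
        p - (Polynomial.aeval (MvPolynomial.X 0) a +
          Polynomial.aeval (MvPolynomial.X 0) b * MvPolynomial.X 1)) ?_ ?_ fun s hs => ?_
  · rintro f g ⟨a, ha, b, hb, h⟩ ⟨a', ha', b', hb', h'⟩
    refine ⟨a + a', add_mem ha ha', b + b', add_mem hb hb', ?_⟩
    convert dvd_add h h' using 1
    simp only [map_add]
    ring
  · exact ⟨0, zero_mem _, 0, zero_mem _, by simp⟩
  · have hsd : s 0 + s 1 ≤ d := by
      have := (MvPolynomial.le_totalDegree hs).trans hp
      rwa [Finsupp.sum_fintype _ _ (fun _ => rfl), Fin.sum_univ_two] at this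
    rw [MvPolynomial.monomial_eq, Finsupp.prod_fintype _ _ (fun _ => pow_zero _),
      Fin.prod_univ_two]
    have hdvd : ∀ m : ℕ, (MvPolynomial.X 1 : MvPolynomial (Fin 2) ℝ) ^ 2 +
        Polynomial.aeval (MvPolynomial.X 0) q ∣ ((MvPolynomial.X 1 : MvPolynomial (Fin 2) ℝ) ^ 2) ^ m -
          (-Polynomial.aeval (MvPolynomial.X 0) q) ^ m := fun m => by
      simpa only [sub_neg_eq_add] using sub_dvd_pow_sub_pow
        ((MvPolynomial.X 1 : MvPolynomial (Fin 2) ℝ) ^ 2) (-Polynomial.aeval (MvPolynomial.X 0) q) m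
    have hnat : ∀ m : ℕ, (C (p.coeff s) * X ^ s 0 * (-q) ^ m).natDegree ≤ s 0 + 4 * m := fun m => by
      refine natDegree_mul_le.trans (add_le_add (natDegree_C_mul_X_pow_le _ _) ?_)
      rw [natDegree_pow, natDegree_neg, hdeg, mul_comm]
    obtain ⟨m, hm | hm⟩ := Nat.even_or_odd' (s 1)
    · refine ⟨C (p.coeff s) * X ^ s 0 * (-q) ^ m,
        mem_degreeLT_of_natDegree_lt ((hnat m).trans_lt (by omega)), 0, zero_mem _, ?_⟩
      convert (hdvd m).mul_left (MvPolynomial.C (p.coeff s) * MvPolynomial.X 0 ^ s 0) using 1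
      rw [hm]
      simp only [map_mul, map_pow, map_neg, aeval_C, aeval_X, map_zero,
        MvPolynomial.algebraMap_eq]
      ring
    · refine ⟨0, zero_mem _, C (p.coeff s) * X ^ s 0 * (-q) ^ m,
        mem_degreeLT_of_natDegree_lt ((hnat m).trans_lt (by omega)), ?_⟩
      convert (hdvd m).mul_left
        (MvPolynomial.C (p.coeff s) * MvPolynomial.X 0 ^ s 0 * MvPolynomial.X 1) using 1
      rw [hm]
      simp only [map_mul, map_pow, map_neg, aeval_C, aeval_X, map_zero,
        MvPolynomial.algebraMap_eq]
      ring

lemma MvPolynomial.totalDegree_aeval_X_le {σ : Type*} (i : σ) (a : ℝ[X]) :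
    (Polynomial.aeval (MvPolynomial.X i : MvPolynomial σ ℝ) a).totalDegree ≤ a.natDegree := by
  rw [aeval_eq_sum_range]
  refine MvPolynomial.totalDegree_finsetSum_le fun j hj => ?_
  refine (MvPolynomial.totalDegree_smul_le _ _).trans ?_
  rw [MvPolynomial.totalDegree_X_pow]
  exact Nat.lt_succ_iff.1 (Finset.mem_range.1 hj)

lemma MvPolynomial.eval_aeval_X {σ : Type*} (w : σ → ℝ) (i : σ) (a : ℝ[X]) :
    MvPolynomial.eval w (Polynomial.aeval (MvPolynomial.X i) a) = a.eval (w i) := by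
  induction a using Polynomial.induction_on' with
  | add p q hp hq => simp [hp, hq]
  | monomial n c => simp

lemma IsSosLe.curveSos {q : ℝ[X]} (hmonic : q.Monic) (hdeg : q.natDegree = 4) {l : ℝ[X]} {N : ℕ}
    (h : IsSosLe q (AdjoinRoot.of (curvePoly q) l) N) : CurveSos q N l 0 := by
  obtain ⟨r, g, hg, hN⟩ := h
  have hdP : (curvePoly q).degree = 2 := degree_X_pow_add_C (by norm_num) _
  have hrep : ∀ i, AdjoinRoot.mk (curvePoly q) (C (repB q (g i)) * X + C (repA q (g i))) = g i :=
    fun i => by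
      have h1 := AdjoinRoot.mk_leftInverse (curvePoly_monic q) (g i)
      have h2 : (curveRep q (g i)).degree ≤ 1 := by
        obtain ⟨p, hp⟩ := AdjoinRoot.mk_surjective (g i)
        rw [curveRep, ← hp, AdjoinRoot.modByMonicHom_mk]
        have := degree_modByMonic_lt p (curvePoly_monic q)
        rw [hdP] at this
        exact Order.le_of_lt_succ this
      rw [repA, repB, ← eq_X_add_C_of_degree_le_one h2]
      exact h1
  have hdvd : curvePoly q ∣
      C (-∑ i, 2 * repA q (g i) * repB q (g i)) * X +
        C (l - ∑ i, (repA q (g i) ^ 2 - q * repB q (g i) ^ 2)) := by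
    rw [← AdjoinRoot.mk_eq_zero]
    have hX : AdjoinRoot.mk (curvePoly q) X ^ 2 = -AdjoinRoot.mk (curvePoly q) (C q) := by
      rw [← map_pow, ← map_neg, AdjoinRoot.mk_eq_mk, sub_neg_eq_add]
      exact dvd_rfl
    have hg' : AdjoinRoot.mk (curvePoly q) (C l) = ∑ i, g i ^ 2 := hg
    simp only [map_add, map_mul, map_sub, map_neg, hg', map_sum, map_pow, ← Finset.sum_neg_distrib,
      Finset.sum_mul, ← Finset.sum_sub_distrib, ← Finset.sum_add_distrib]
    refine Finset.sum_eq_zero fun i _ => ?_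
    nth_rewrite 3 [← hrep i]
    simp only [map_add, map_mul, map_ofNat]
    linear_combination AdjoinRoot.mk (curvePoly q) (C (repB q (g i))) ^ 2 * hX
  have h0 := eq_zero_of_dvd_of_degree_lt hdvd (by
    rw [hdP]
    exact degree_linear_le.trans_lt (by norm_num))
  refine ⟨r, fun i => repA q (g i), fun i => repB q (g i), fun i => ?_, ?_, ?_⟩
  · rw [natDegree_curveNorm_le_iff hmonic hdeg]
    have := hN i
    unfold curveDelta at this
    split_ifs at this with hb
    · exact ⟨this, fun h => absurd hb h⟩
    · obtain ⟨h1, h2⟩ := max_le_iff.1 this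
      exact ⟨h1, fun _ => (add_comm _ _).trans_le h2⟩
  · have := congrArg (fun p => p.coeff 0) h0
    simp only [coeff_add, coeff_C_mul, coeff_X_zero, mul_zero, zero_add, coeff_C_zero,
      coeff_zero] at this
    exact sub_eq_zero.1 this
  · have := congrArg (fun p => p.coeff 1) h0
    simp only [coeff_add, coeff_C_mul, coeff_X_one, mul_one, coeff_C_succ, add_zero,
      coeff_zero] at this
    exact (neg_eq_zero.1 this).symm

lemma CurveSos.exists_mvPolynomial {q : ℝ[X]} (hmonic : q.Monic) (hdeg : q.natDegree = 4)
    {a b : ℝ[X]} {k : ℕ} (h : CurveSos q k a b) :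
    ∃ (m : ℕ) (P : Fin m → MvPolynomial (Fin 2) ℝ), (∀ i, (P i).totalDegree ≤ k) ∧
      (MvPolynomial.X 1 : MvPolynomial (Fin 2) ℝ) ^ 2 + Polynomial.aeval (MvPolynomial.X 0) q ∣
        (Polynomial.aeval (MvPolynomial.X 0) a +
          Polynomial.aeval (MvPolynomial.X 0) b * MvPolynomial.X 1) - ∑ i, P i ^ 2 := by
  obtain ⟨m, A, B, hk, rfl, rfl⟩ := h
  refine ⟨m, fun i => Polynomial.aeval (MvPolynomial.X 0) (A i) +
    Polynomial.aeval (MvPolynomial.X 0) (B i) * MvPolynomial.X 1, fun i => ?_, ?_⟩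
  · obtain ⟨h1, h2⟩ := (natDegree_curveNorm_le_iff hmonic hdeg).1 (hk i)
    refine (MvPolynomial.totalDegree_add _ _).trans (max_le
      ((MvPolynomial.totalDegree_aeval_X_le _ _).trans h1) ?_)
    by_cases hB : B i = 0
    · simp [hB]
    · refine (MvPolynomial.totalDegree_mul _ _).trans ?_
      have h3 := MvPolynomial.totalDegree_aeval_X_le (0 : Fin 2) (B i)
      have h4 := h2 hB
      rw [MvPolynomial.totalDegree_X]
      omega
  · rw [map_sum, map_sum, Finset.sum_mul, ← Finset.sum_add_distrib, ← Finset.sum_sub_distrib]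
    refine Finset.dvd_sum fun i _ => ⟨-Polynomial.aeval (MvPolynomial.X 0) (B i) ^ 2, ?_⟩
    simp only [map_sub, map_mul, map_pow, map_ofNat]
    ring

/-- Corollary 2.14: if `(x−α)(β−x)` is a sum of squares of elements
of `δ`-degree `≤ N` in `ℝ[C]` (with `N ≥ 2`), then the ideal `(y² + q(x))` is
`(d, N+d−1)`-sos for every `d ≥ 1`: every polynomial `p` of degree `≤ d` nonnegative
on `C(ℝ)` is congruent mod `(y² + q(x))` to a sum of squares of polynomials of degree
`≤ N + d − 1`. -/
theorem curve_ideal_is_d_k_sos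
    (q : Polynomial ℝ) (hmonic : q.Monic) (hdeg : q.natDegree = 4)
    (hsep : Squarefree (q.map (algebraMap ℝ ℂ)))
    (hindef : ∃ x : ℝ, q.eval x < 0)
    (α β : ℝ) (hα : q.eval α = 0) (hβ : q.eval β = 0)
    (hαβ : ∀ x : ℝ, q.eval x = 0 → α ≤ x ∧ x ≤ β)
    (N : ℕ) (hN : 2 ≤ N)
    (hsos : IsSosLe q (AdjoinRoot.of (curvePoly q) ((X - C α) * (C β - X))) N) :
    ∀ d : ℕ, 1 ≤ d → ∀ p : MvPolynomial (Fin 2) ℝ, p.totalDegree ≤ d →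
      (∀ u v : ℝ, v ^ 2 + q.eval u = 0 → 0 ≤ MvPolynomial.eval ![u, v] p) →
      ∃ (m : ℕ) (P : Fin m → MvPolynomial (Fin 2) ℝ),
        (∀ i, (P i).totalDegree ≤ N + d - 1) ∧
        p - ∑ i, P i ^ 2 ∈ Ideal.span
          {(MvPolynomial.X 1 : MvPolynomial (Fin 2) ℝ) ^ 2 +
            Polynomial.aeval (MvPolynomial.X 0) q} := by
  intro d hd p hp hpos
  have hsq := squarefree_of_squarefree_map hsep
  obtain ⟨a, ha, b, hb, hab⟩ := exists_curve_reduction hdeg hp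
  have hpsd : CurveNonneg q a b := fun u v huv => by
    obtain ⟨r, hr⟩ := hab
    have h1 := congrArg (MvPolynomial.eval ![u, v]) hr
    simp only [map_sub, map_add, map_mul, map_pow, MvPolynomial.eval_aeval_X, MvPolynomial.eval_X,
      Matrix.cons_val_zero, Matrix.cons_val_one, huv, zero_mul] at h1
    linarith [hpos u v huv]
  obtain ⟨m, P, hP, hdvd⟩ := (hpsd.curveSos hmonic hdeg hsq hindef hα hβ hαβ hN
    (hsos.curveSos hmonic hdeg) hd ((natDegree_curveNorm_le_iff_degreeLT hmonic hdeg
      (by omega)).2 ⟨ha, hb⟩)).exists_mvPolynomial hmonic hdeg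
  refine ⟨m, P, hP, Ideal.mem_span_singleton.2 ?_⟩
  simpa only [sub_add_sub_cancel] using dvd_add hab hdvd

end
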